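/- Let H be a Hopf algebra with bijective antipode, σ a left 2-cocycle on H, and define S₂:H→H by S₂(h)=Σσ⁻¹(h₃⊗S⁻¹(h₂))S⁻¹(h₁). With the twisted product h·k = Σσ(k₁⊗h₁)k₂h₂, one has Σ S₂(h₁)·h₂ = ε(h)·1 and Σ h₁·S₂(h₂) = ε(h)·1 for every h∈H. -/

import Mathlib

open TensorProduct Coalgebra HopfAlgebra

noncomputable section

variable (k H : Type) [Field k] [Ring H] [HopfAlgebra k H]

/-- Convolution product of two linear functionals on a coalgebra. -/
def conv {C : Type} [AddCommGroup C] [Module k C] [Coalgebra k C]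
    (f g : C →ₗ[k] k) : C →ₗ[k] k :=
  LinearMap.mul' k k ∘ₗ TensorProduct.map f g ∘ₗ Coalgebra.comul

variable {k H}

/-- `h ⊗ k ⊗ m ↦ ε(h)·σ(k ⊗ m)`. -/
def p23 (σ : H ⊗[k] H →ₗ[k] k) : H ⊗[k] (H ⊗[k] H) →ₗ[k] k :=
  σ ∘ₗ (TensorProduct.lid k (H ⊗[k] H)).toLinearMap ∘ₗ
    TensorProduct.map Coalgebra.counit LinearMap.id

/-- `h ⊗ k ⊗ m ↦ σ(h ⊗ km)`. -/
def p1_23 (σ : H ⊗[k] H →ₗ[k] k) : H ⊗[k] (H ⊗[k] H) →ₗ[k] k :=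
  σ ∘ₗ TensorProduct.map LinearMap.id (LinearMap.mul' k H)

/-- `h ⊗ k ⊗ m ↦ σ(h ⊗ k)·ε(m)`. -/
def p12 (σ : H ⊗[k] H →ₗ[k] k) : H ⊗[k] (H ⊗[k] H) →ₗ[k] k :=
  σ ∘ₗ TensorProduct.map LinearMap.id
    ((TensorProduct.rid k H).toLinearMap ∘ₗ TensorProduct.map LinearMap.id Coalgebra.counit)

/-- `h ⊗ k ⊗ m ↦ σ(hk ⊗ m)`. -/
def p12_3 (σ : H ⊗[k] H →ₗ[k] k) : H ⊗[k] (H ⊗[k] H) →ₗ[k] k :=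
  σ ∘ₗ TensorProduct.map (LinearMap.mul' k H) LinearMap.id ∘ₗ
    (TensorProduct.assoc k H H H).symm.toLinearMap

/-- `h ⊗ k ⊗ m ↦ σ(h ⊗ m)·ε(k)`. -/
def p13 (σ : H ⊗[k] H →ₗ[k] k) : H ⊗[k] (H ⊗[k] H) →ₗ[k] k :=
  σ ∘ₗ TensorProduct.map LinearMap.id
    ((TensorProduct.lid k H).toLinearMap ∘ₗ TensorProduct.map Coalgebra.counit LinearMap.id)

/-- σ is a (normalized) left 2-cocycle: `σ(h⊗1)=σ(1⊗h)=ε(h)` and the cocycle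
condition `Σσ(k₁⊗m₁)σ(h⊗k₂m₂)=Σσ(h₁⊗k₁)σ(h₂k₂⊗m)`, expressed as the
convolution identity `σ₂₃ * σ₁,₂₃ = σ₁₂ * σ₁₂,₃` of functionals on `H ⊗ H ⊗ H`. -/
def IsLeftCocycle (σ : H ⊗[k] H →ₗ[k] k) : Prop :=
  (∀ h : H, σ (h ⊗ₜ 1) = Coalgebra.counit h ∧ σ ((1 : H) ⊗ₜ h) = Coalgebra.counit h) ∧
  conv k (p23 σ) (p1_23 σ) = conv k (p12 σ) (p12_3 σ)

/-- σ' is a convolution inverse of σ. -/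
def IsConvInverse (σ σ' : H ⊗[k] H →ₗ[k] k) : Prop :=
  conv k σ σ' = Coalgebra.counit ∧ conv k σ' σ = Coalgebra.counit

/-- Iterated comultiplication `h ↦ h₁ ⊗ (h₂ ⊗ h₃)`. -/
def Delta3 : H →ₗ[k] H ⊗[k] (H ⊗[k] H) :=
  TensorProduct.map LinearMap.id Coalgebra.comul ∘ₗ Coalgebra.comul

/-- The twisted product of `A_σ`: `h ⊗ k ↦ h·k = Σ σ(k₁⊗h₁) k₂h₂`. -/
def tmul (σ : H ⊗[k] H →ₗ[k] k) : H ⊗[k] H →ₗ[k] H :=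
  (TensorProduct.lid k H).toLinearMap ∘ₗ
    TensorProduct.map (σ ∘ₗ (TensorProduct.comm k H H).toLinearMap)
      (LinearMap.mul' k H ∘ₗ (TensorProduct.comm k H H).toLinearMap) ∘ₗ
    (TensorProduct.tensorTensorTensorComm k H H H H).toLinearMap ∘ₗ
    TensorProduct.map Coalgebra.comul Coalgebra.comul

/-- `S₂(h) = Σ σ⁻¹(h₃⊗S⁻¹(h₂))·S⁻¹(h₁)`. -/
def S2 (σ' : H ⊗[k] H →ₗ[k] k) (Sinv : H →ₗ[k] H) : H →ₗ[k] H :=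
  (TensorProduct.rid k H).toLinearMap ∘ₗ
    TensorProduct.map Sinv
      (σ' ∘ₗ TensorProduct.map LinearMap.id Sinv ∘ₗ (TensorProduct.comm k H H).toLinearMap) ∘ₗ
    Delta3

section AntipodeInverse

open CoassocSimps WithConv

local notation "δ" => (comul : H →ₗ[k] H ⊗[k] H)
local notation "ε" => (counit : H →ₗ[k] k)
local notation "idH" => (LinearMap.id : H →ₗ[k] H)
local infix:90 "⊗ₘ" => TensorProduct.map
local notation "assocH" => TensorProduct.assoc k H

/-- Iterated comultiplication `h ↦ h₁ ⊗ (h₂ ⊗ (h₃ ⊗ h₄))`. -/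
def Delta4 : H →ₗ[k] H ⊗[k] (H ⊗[k] (H ⊗[k] H)) := (idH ⊗ₘ Delta3) ∘ₗ δ

lemma map_comul_comul_comp_comul :
    (δ ⊗ₘ δ) ∘ₗ δ = (assocH H (H ⊗[k] H)).symm.toLinearMap ∘ₗ
      (idH ⊗ₘ ((assocH H H).toLinearMap ∘ₗ (δ ⊗ₘ idH))) ∘ₗ Delta3 := by
  unfold Delta3
  simp only [coassoc_simps]

lemma map_id_map_counit_comp_Delta3 {M N : Type} [AddCommGroup M] [Module k M] [AddCommGroup N]
    [Module k N] (f : k →ₗ[k] M) (g : H →ₗ[k] N) :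
    (idH ⊗ₘ ((f ∘ₗ ε) ⊗ₘ g)) ∘ₗ Delta3 =
      (idH ⊗ₘ ((f ⊗ₘ g) ∘ₗ (TensorProduct.lid k H).symm.toLinearMap)) ∘ₗ δ := by
  have : (f ∘ₗ ε) ⊗ₘ g = (f ⊗ₘ g) ∘ₗ LinearMap.rTensor H ε := by ext; simp
  rw [this, Delta3, ← LinearMap.comp_assoc, ← TensorProduct.map_comp, LinearMap.comp_assoc,
    rTensor_counit_comp_comul]
  rfl

/-- The antipode is anti-comultiplicative. -/
lemma comul_comp_antipode :
    δ ∘ₗ antipode k = (antipode k ⊗ₘ antipode k) ∘ₗ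
      (TensorProduct.comm k H H).toLinearMap ∘ₗ δ := by
  apply toConv_injective
  symm
  apply left_inv_eq_right_inv (a := toConv δ) ?_ LinearMap.comul_right_inv
  let Φ : H ⊗[k] (H ⊗[k] H) →ₗ[k] H ⊗[k] H :=
    (idH ⊗ₘ (LinearMap.mul' k H ∘ₗ (antipode k ⊗ₘ idH))) ∘ₗ
      (TensorProduct.leftComm k H H H).toLinearMap
  have h : LinearMap.mul' k (H ⊗[k] H) ∘ₗ
      (((antipode k ⊗ₘ antipode k) ∘ₗ (TensorProduct.comm k H H).toLinearMap) ⊗ₘ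
        LinearMap.id) ∘ₗ (assocH H (H ⊗[k] H)).symm.toLinearMap ∘ₗ (idH ⊗ₘ (assocH H H).toLinearMap) =
      Φ ∘ₗ (idH ⊗ₘ ((LinearMap.mul' k H ∘ₗ (antipode k).rTensor H) ⊗ₘ idH)) := by
    ext a b c d
    simp [Φ]
  ext1
  trans (Φ ∘ₗ (idH ⊗ₘ ((LinearMap.mul' k H ∘ₗ (antipode k).rTensor H) ⊗ₘ idH))) ∘ₗ
    (idH ⊗ₘ (δ ⊗ₘ idH)) ∘ₗ Delta3
  · rw [← h, LinearMap.convMul_def]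
    trans LinearMap.mul' k (H ⊗[k] H) ∘ₗ
      (((antipode k ⊗ₘ antipode k) ∘ₗ (TensorProduct.comm k H H).toLinearMap) ⊗ₘ
        LinearMap.id) ∘ₗ (δ ⊗ₘ δ) ∘ₗ δ
    · simp [coassoc_simps]
    · rw [map_comul_comul_comp_comul]
      simp [coassoc_simps]
  · have h' : (idH ⊗ₘ ((LinearMap.mul' k H ∘ₗ (antipode k).rTensor H) ⊗ₘ idH)) ∘ₗ
      (idH ⊗ₘ (δ ⊗ₘ idH)) ∘ₗ Delta3 = (idH ⊗ₘ ((Algebra.linearMap k H ∘ₗ ε) ⊗ₘ idH)) ∘ₗ Delta3 := by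
      rw [← mul_antipode_rTensor_comul]
      simp [coassoc_simps]
    rw [LinearMap.comp_assoc, h', map_id_map_counit_comp_Delta3]
    trans (TensorProduct.mk k H H 1) ∘ₗ LinearMap.mul' k H ∘ₗ (antipode k).rTensor H ∘ₗ δ
    · simp only [← LinearMap.comp_assoc]
      congr 1
      ext a b
      simp [Φ]
    · rw [mul_antipode_rTensor_comul]
      ext a
      simp [LinearMap.convOne_def, Algebra.algebraMap_eq_smul_one, Algebra.TensorProduct.one_def]

variable {Sinv : H →ₗ[k] H}

lemma comul_comp_antipode_inverse
    (hl : Sinv ∘ₗ antipode k = LinearMap.id) (hr : antipode k ∘ₗ Sinv = LinearMap.id) :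
    δ ∘ₗ Sinv = (Sinv ⊗ₘ Sinv) ∘ₗ (TensorProduct.comm k H H).toLinearMap ∘ₗ δ := by
  have h := congrArg (fun f : H →ₗ[k] H ⊗[k] H ↦
    (Sinv ⊗ₘ Sinv) ∘ₗ (TensorProduct.comm k H H).toLinearMap ∘ₗ f ∘ₗ Sinv) comul_comp_antipode
  simp only [coassoc_simps, hl, hr] at h
  simpa [coassoc_simps] using h.symm

lemma counit_comp_antipode_inverse (hr : antipode k ∘ₗ Sinv = LinearMap.id) :
    ε ∘ₗ Sinv = ε := by
  ext a
  simpa using (counit_antipode (R := k) (Sinv a)).symm.trans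
    (congrArg (counit (R := k)) (LinearMap.congr_fun hr a))

lemma mul_comm_antipode_inverse_left
    (hl : Sinv ∘ₗ antipode k = LinearMap.id) (hr : antipode k ∘ₗ Sinv = LinearMap.id) :
    LinearMap.mul' k H ∘ₗ (TensorProduct.comm k H H).toLinearMap ∘ₗ (Sinv ⊗ₘ idH) ∘ₗ δ =
      Algebra.linearMap k H ∘ₗ ε := by
  have h : antipode k ∘ₗ LinearMap.mul' k H ∘ₗ (TensorProduct.comm k H H).toLinearMap ∘ₗ
      (Sinv ⊗ₘ idH) ∘ₗ δ = antipode k ∘ₗ Algebra.linearMap k H ∘ₗ ε := by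
    trans LinearMap.mul' k H ∘ₗ (antipode k).lTensor H ∘ₗ δ
    · simp only [← LinearMap.comp_assoc]
      congr 1
      ext a b
      simp [antipode_mul_antidistrib, ← LinearMap.comp_apply (antipode k) Sinv, hr]
    · rw [mul_antipode_lTensor_comul]
      ext a
      simp [Algebra.algebraMap_eq_smul_one]
  simpa [← LinearMap.comp_assoc, hl] using congrArg (fun f : H →ₗ[k] H ↦ Sinv ∘ₗ f) h

lemma mul_comm_antipode_inverse_right
    (hl : Sinv ∘ₗ antipode k = LinearMap.id) (hr : antipode k ∘ₗ Sinv = LinearMap.id) :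
    LinearMap.mul' k H ∘ₗ (TensorProduct.comm k H H).toLinearMap ∘ₗ (idH ⊗ₘ Sinv) ∘ₗ δ =
      Algebra.linearMap k H ∘ₗ ε := by
  have h : antipode k ∘ₗ LinearMap.mul' k H ∘ₗ (TensorProduct.comm k H H).toLinearMap ∘ₗ
      (idH ⊗ₘ Sinv) ∘ₗ δ = antipode k ∘ₗ Algebra.linearMap k H ∘ₗ ε := by
    trans LinearMap.mul' k H ∘ₗ (antipode k).rTensor H ∘ₗ δ
    · simp only [← LinearMap.comp_assoc]
      congr 1
      ext a b
      simp [antipode_mul_antidistrib, ← LinearMap.comp_apply (antipode k) Sinv, hr]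
    · rw [mul_antipode_rTensor_comul]
      ext a
      simp [Algebra.algebraMap_eq_smul_one]
  simpa [← LinearMap.comp_assoc, hl] using congrArg (fun f : H →ₗ[k] H ↦ Sinv ∘ₗ f) h

lemma map_map_comul_comp_Delta3 :
    (idH ⊗ₘ ((assocH H H).toLinearMap ∘ₗ (δ ⊗ₘ idH))) ∘ₗ Delta3 = Delta4 := by
  unfold Delta4 Delta3
  simp only [coassoc_simps]

lemma map_Delta3_comp_comul :
    (Delta3 ⊗ₘ idH) ∘ₗ δ = (assocH (H ⊗[k] H) H).symm.toLinearMap ∘ₗ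
      (idH ⊗ₘ (assocH H H).symm.toLinearMap) ∘ₗ Delta4 := by
  unfold Delta4 Delta3
  simp only [coassoc_simps]

lemma map_map_map_comul_comp_Delta3 : (idH ⊗ₘ (idH ⊗ₘ δ)) ∘ₗ Delta3 = Delta4 := by
  unfold Delta4 Delta3
  simp only [coassoc_simps]

lemma map_counit_counit_comp_Delta4 :
    (idH ⊗ₘ ((TensorProduct.lid k H).toLinearMap ∘ₗ (ε ⊗ₘ
      ((TensorProduct.lid k H).toLinearMap ∘ₗ (ε ⊗ₘ idH))))) ∘ₗ Delta4 = δ := by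
  have h : (TensorProduct.lid k H).toLinearMap ∘ₗ (ε ⊗ₘ idH) ∘ₗ δ = idH := by
    change (TensorProduct.lid k H).toLinearMap ∘ₗ LinearMap.rTensor H ε ∘ₗ δ = idH
    rw [rTensor_counit_comp_comul]
    ext a
    simp
  have h₃ : (idH ⊗ₘ ((TensorProduct.lid k H).toLinearMap ∘ₗ (ε ⊗ₘ idH))) ∘ₗ Delta3 = δ := by
    rw [Delta3, ← LinearMap.comp_assoc, ← TensorProduct.map_comp, LinearMap.comp_assoc, h]
    simp
  have h₂ : (TensorProduct.lid k H).toLinearMap ∘ₗ (ε ⊗ₘ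
      ((TensorProduct.lid k H).toLinearMap ∘ₗ (ε ⊗ₘ idH))) ∘ₗ Delta3 = idH := by
    trans (TensorProduct.lid k H).toLinearMap ∘ₗ (ε ⊗ₘ
      ((TensorProduct.lid k H).toLinearMap ∘ₗ (ε ⊗ₘ idH) ∘ₗ δ)) ∘ₗ δ
    · unfold Delta3
      simp only [coassoc_simps]
    · rw [h, h]
  rw [Delta4, ← LinearMap.comp_assoc, ← TensorProduct.map_comp, LinearMap.comp_assoc, h₂]
  simp

/-- Regrouping `(a₁ ⊗ a₂) ⊗ b ⊗ c ⊗ (d₁ ⊗ d₂) ↦ a₁ ⊗ (a₂ ⊗ b) ⊗ (c ⊗ d₁) ⊗ d₂`. -/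
def regroup : (H ⊗[k] H) ⊗[k] (H ⊗[k] (H ⊗[k] (H ⊗[k] H))) →ₗ[k]
    H ⊗[k] ((H ⊗[k] H) ⊗[k] ((H ⊗[k] H) ⊗[k] H)) :=
  (idH ⊗ₘ ((TensorProduct.assoc k H H _).symm.toLinearMap ∘ₗ
    (idH ⊗ₘ (idH ⊗ₘ (assocH H H).symm.toLinearMap)))) ∘ₗ (assocH H _).toLinearMap

lemma regroup_comp_Delta4 :
    regroup ∘ₗ (δ ⊗ₘ (idH ⊗ₘ (idH ⊗ₘ δ))) ∘ₗ Delta4 =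
      (idH ⊗ₘ (δ ⊗ₘ (δ ⊗ₘ idH))) ∘ₗ Delta4 := by
  unfold Delta4 Delta3 regroup
  simp only [coassoc_simps]

/-- Regrouping `a ⊗ x ⊗ y ⊗ d ↦ (x ⊗ y) ⊗ (a ⊗ d)`. -/
def gatherMiddle : H ⊗[k] ((H ⊗[k] H) ⊗[k] ((H ⊗[k] H) ⊗[k] H)) →ₗ[k]
    ((H ⊗[k] H) ⊗[k] (H ⊗[k] H)) ⊗[k] (H ⊗[k] H) :=
  (TensorProduct.assoc k (H ⊗[k] H) (H ⊗[k] H) (H ⊗[k] H)).symm.toLinearMap ∘ₗ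
    (LinearMap.id ⊗ₘ (TensorProduct.leftComm k H (H ⊗[k] H) H).toLinearMap) ∘ₗ
    (TensorProduct.leftComm k H (H ⊗[k] H) ((H ⊗[k] H) ⊗[k] H)).toLinearMap

variable (Sinv) in
/-- `(b₁ ⊗ b₂) ⊗ (c₁ ⊗ c₂) ↦ σ'(c₁ ⊗ S⁻¹(b₂)) σ(c₂ ⊗ S⁻¹(b₁))`. -/
def convIntegrand (σ σ' : H ⊗[k] H →ₗ[k] k) : (H ⊗[k] H) ⊗[k] (H ⊗[k] H) →ₗ[k] k :=
  LinearMap.mul' k k ∘ₗ (σ' ⊗ₘ σ) ∘ₗ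
    (TensorProduct.tensorTensorTensorComm k H H H H).toLinearMap ∘ₗ
    (LinearMap.id ⊗ₘ ((Sinv ⊗ₘ Sinv) ∘ₗ (TensorProduct.comm k H H).toLinearMap)) ∘ₗ
    (TensorProduct.comm k (H ⊗[k] H) (H ⊗[k] H)).toLinearMap

lemma convIntegrand_comul_tmul_comul {σ σ' : H ⊗[k] H →ₗ[k] k} (hσ' : conv k σ' σ = counit)
    (hl : Sinv ∘ₗ antipode k = LinearMap.id) (hr : antipode k ∘ₗ Sinv = LinearMap.id) (b c : H) :
    convIntegrand Sinv σ σ' (comul b ⊗ₜ comul c) = counit (R := k) b * counit (R := k) c := by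
  have h₁ := LinearMap.congr_fun (comul_comp_antipode_inverse hl hr) b
  have h₂ := LinearMap.congr_fun (counit_comp_antipode_inverse hr) b
  have h₃ := LinearMap.congr_fun hσ' (c ⊗ₜ Sinv b)
  simp only [LinearMap.comp_apply, LinearEquiv.coe_coe] at h₁ h₂
  simp only [conv, LinearMap.comp_apply, TensorProduct.comul_tmul, h₁] at h₃
  simp only [TensorProduct.counit_tmul, h₂] at h₃
  refine Eq.trans ?_ h₃
  simp [convIntegrand, TensorProduct.AlgebraTensorModule.tensorTensorTensorComm_eq]

lemma tmul_S2_left {σ σ' : H ⊗[k] H →ₗ[k] k} (hσ' : conv k σ' σ = counit)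
    (hl : Sinv ∘ₗ antipode k = LinearMap.id) (hr : antipode k ∘ₗ Sinv = LinearMap.id) :
    tmul σ ∘ₗ (S2 σ' Sinv ⊗ₘ LinearMap.id) ∘ₗ δ = Algebra.linearMap k H ∘ₗ ε := by
  let s : H ⊗[k] (H ⊗[k] H) →ₗ[k] H := (TensorProduct.rid k H).toLinearMap ∘ₗ
    (Sinv ⊗ₘ (σ' ∘ₗ (LinearMap.id ⊗ₘ Sinv) ∘ₗ (TensorProduct.comm k H H).toLinearMap))
  let Θ := (TensorProduct.lid k H).toLinearMap ∘ₗ (convIntegrand Sinv σ σ' ⊗ₘ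
    (LinearMap.mul' k H ∘ₗ (TensorProduct.comm k H H).toLinearMap ∘ₗ (Sinv ⊗ₘ idH))) ∘ₗ
    gatherMiddle
  have h₁ : tmul σ ∘ₗ (s ⊗ₘ idH) ∘ₗ (assocH (H ⊗[k] H) H).symm.toLinearMap ∘ₗ
      (idH ⊗ₘ (assocH H H).symm.toLinearMap) =
      Θ ∘ₗ regroup ∘ₗ (δ ⊗ₘ (idH ⊗ₘ (idH ⊗ₘ δ))) := by
    ext a b c d
    have h := LinearMap.congr_fun (comul_comp_antipode_inverse hl hr) a
    simp only [LinearMap.comp_apply, LinearEquiv.coe_coe] at h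
    simp [s, _root_.tmul, Θ, h]
    generalize (comul a : H ⊗[k] H) = x
    generalize (comul d : H ⊗[k] H) = y
    induction x with
    | zero => simp
    | add x x' hx hx' => simp only [add_tmul, map_add, smul_add, hx, hx']
    | tmul a₁ a₂ =>
      induction y with
      | zero => simp
      | add y y' hy hy' => simp only [tmul_add, map_add, hy, hy']
      | tmul d₁ d₂ =>
        simp [regroup, gatherMiddle, convIntegrand, ← smul_tmul']
        rw [smul_tmul', smul_eq_mul]
  have h₂ : Θ ∘ₗ (idH ⊗ₘ (δ ⊗ₘ (δ ⊗ₘ idH))) =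
      LinearMap.mul' k H ∘ₗ (TensorProduct.comm k H H).toLinearMap ∘ₗ (Sinv ⊗ₘ idH) ∘ₗ
      (idH ⊗ₘ ((TensorProduct.lid k H).toLinearMap ∘ₗ (ε ⊗ₘ
        ((TensorProduct.lid k H).toLinearMap ∘ₗ (ε ⊗ₘ idH))))) := by
    ext a b c d
    simp [Θ, gatherMiddle, convIntegrand_comul_tmul_comul hσ' hl hr, smul_smul, mul_comm]
  calc tmul σ ∘ₗ (S2 σ' Sinv ⊗ₘ LinearMap.id) ∘ₗ δ
      = tmul σ ∘ₗ (s ⊗ₘ idH) ∘ₗ (Delta3 ⊗ₘ idH) ∘ₗ δ := by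
        have : S2 σ' Sinv ⊗ₘ idH = (s ⊗ₘ idH) ∘ₗ (Delta3 ⊗ₘ idH) := by
          rw [← TensorProduct.map_comp, LinearMap.comp_id]; rfl
        rw [this]; rfl
    _ = (tmul σ ∘ₗ (s ⊗ₘ idH) ∘ₗ (assocH (H ⊗[k] H) H).symm.toLinearMap ∘ₗ
          (idH ⊗ₘ (assocH H H).symm.toLinearMap)) ∘ₗ Delta4 := by
        rw [map_Delta3_comp_comul]; rfl
    _ = (Θ ∘ₗ (idH ⊗ₘ (δ ⊗ₘ (δ ⊗ₘ idH)))) ∘ₗ Delta4 := by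
        rw [h₁]
        change Θ ∘ₗ (regroup ∘ₗ (δ ⊗ₘ (idH ⊗ₘ (idH ⊗ₘ δ))) ∘ₗ Delta4) = _
        rw [regroup_comp_Delta4]; rfl
    _ = Algebra.linearMap k H ∘ₗ ε := by
        rw [h₂, ← mul_comm_antipode_inverse_left hl hr]
        simp only [LinearMap.comp_assoc]
        rw [map_counit_counit_comp_Delta4]

variable (Sinv) in
/-- `a ⊗ b ⊗ c ⊗ d ↦ σ(S⁻¹(b) ⊗ a) σ'(d ⊗ S⁻¹(c))`. -/
def outerPairing (σ σ' : H ⊗[k] H →ₗ[k] k) : H ⊗[k] (H ⊗[k] (H ⊗[k] H)) →ₗ[k] k :=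
  LinearMap.mul' k k ∘ₗ ((σ ∘ₗ (Sinv ⊗ₘ idH) ∘ₗ (TensorProduct.comm k H H).toLinearMap) ⊗ₘ
    (σ' ∘ₗ (idH ⊗ₘ Sinv) ∘ₗ (TensorProduct.comm k H H).toLinearMap)) ∘ₗ
    (assocH H (H ⊗[k] H)).symm.toLinearMap

/-- Regrouping `(a₁ ⊗ a₂) ⊗ (b₁ ⊗ b₂) ⊗ m ↦ a₁ ⊗ (a₂ ⊗ b₁) ⊗ b₂ ⊗ m`. -/
def pairInner : (H ⊗[k] H) ⊗[k] ((H ⊗[k] H) ⊗[k] (H ⊗[k] H)) →ₗ[k]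
    H ⊗[k] ((H ⊗[k] H) ⊗[k] (H ⊗[k] (H ⊗[k] H))) :=
  (idH ⊗ₘ ((assocH H _).symm.toLinearMap ∘ₗ (idH ⊗ₘ (assocH H _).toLinearMap))) ∘ₗ
    (assocH H _).toLinearMap

lemma pairInner_comp_Delta3 :
    pairInner ∘ₗ (δ ⊗ₘ (δ ⊗ₘ δ)) ∘ₗ Delta3 = (idH ⊗ₘ (δ ⊗ₘ (idH ⊗ₘ δ))) ∘ₗ Delta4 := by
  unfold pairInner Delta4 Delta3
  simp only [coassoc_simps]

variable (Sinv) in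
/-- `(a₁ ⊗ a₂) ⊗ (b₁ ⊗ b₂) ⊗ m ↦ S⁻¹(b₁)a₂ ⊗ a₁ ⊗ b₂ ⊗ m`. -/
def mulInner : (H ⊗[k] H) ⊗[k] ((H ⊗[k] H) ⊗[k] (H ⊗[k] H)) →ₗ[k]
    H ⊗[k] (H ⊗[k] (H ⊗[k] (H ⊗[k] H))) :=
  (TensorProduct.leftComm k H H _).toLinearMap ∘ₗ
    (idH ⊗ₘ ((LinearMap.mul' k H ∘ₗ (TensorProduct.comm k H H).toLinearMap ∘ₗ
      (idH ⊗ₘ Sinv)) ⊗ₘ LinearMap.id)) ∘ₗ pairInner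

lemma map_id_map_counit_comp_Delta4 {N : Type} [AddCommGroup N]
    [Module k N] (g : H ⊗[k] H →ₗ[k] N) :
    (idH ⊗ₘ ((TensorProduct.lid k N).toLinearMap ∘ₗ (ε ⊗ₘ g))) ∘ₗ Delta4 =
      (idH ⊗ₘ g) ∘ₗ Delta3 := by
  have h : (TensorProduct.lid k N).toLinearMap ∘ₗ (ε ⊗ₘ g) =
      g ∘ₗ (TensorProduct.lid k _).toLinearMap ∘ₗ (ε ⊗ₘ LinearMap.id) := by ext; simp
  have h' : (TensorProduct.lid k _).toLinearMap ∘ₗ (ε ⊗ₘ LinearMap.id) ∘ₗ Delta3 = δ := by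
    have : (TensorProduct.lid k (H ⊗[k] H)).toLinearMap ∘ₗ (ε ⊗ₘ LinearMap.id) ∘ₗ Delta3 =
        δ ∘ₗ (TensorProduct.lid k H).toLinearMap ∘ₗ LinearMap.rTensor H ε ∘ₗ δ := by
      unfold Delta3
      simp only [← LinearMap.comp_assoc]
      congr 1
      ext; simp
    rw [this, rTensor_counit_comp_comul]
    ext; simp
  rw [h, Delta4, ← LinearMap.comp_assoc, ← TensorProduct.map_comp]
  simp only [LinearMap.comp_assoc, h']
  rw [Delta3, ← LinearMap.comp_assoc, ← TensorProduct.map_comp]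

lemma mulInner_comp_Delta3
    (hl : Sinv ∘ₗ antipode k = LinearMap.id) (hr : antipode k ∘ₗ Sinv = LinearMap.id) :
    mulInner Sinv ∘ₗ (δ ⊗ₘ (δ ⊗ₘ δ)) ∘ₗ Delta3 = TensorProduct.mk k H _ 1 ∘ₗ Delta4 := by
  rw [mulInner, LinearMap.comp_assoc, LinearMap.comp_assoc, pairInner_comp_Delta3]
  trans TensorProduct.mk k H _ 1 ∘ₗ (idH ⊗ₘ ((TensorProduct.lid k _).toLinearMap ∘ₗ
    (ε ⊗ₘ (idH ⊗ₘ δ)))) ∘ₗ Delta4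
  swap
  · rw [map_id_map_counit_comp_Delta4, map_map_map_comul_comp_Delta3]
  simp only [← LinearMap.comp_assoc]
  congr 1
  ext a b c d
  have h := LinearMap.congr_fun (mul_comm_antipode_inverse_right hl hr) b
  simp at h
  simp [h, Algebra.algebraMap_eq_smul_one, ← smul_tmul']

lemma tmul_S2_right {σ σ' : H ⊗[k] H →ₗ[k] k}
    (hl : Sinv ∘ₗ antipode k = LinearMap.id) (hr : antipode k ∘ₗ Sinv = LinearMap.id) :
    tmul σ ∘ₗ (idH ⊗ₘ S2 σ' Sinv) ∘ₗ δ =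
      Algebra.linearMap k H ∘ₗ outerPairing Sinv σ σ' ∘ₗ Delta4 := by
  let s : H ⊗[k] (H ⊗[k] H) →ₗ[k] H := (TensorProduct.rid k H).toLinearMap ∘ₗ
    (Sinv ⊗ₘ (σ' ∘ₗ (LinearMap.id ⊗ₘ Sinv) ∘ₗ (TensorProduct.comm k H H).toLinearMap))
  let Ψ := (TensorProduct.rid k H).toLinearMap ∘ₗ (idH ⊗ₘ outerPairing Sinv σ σ')
  have h₁ : tmul σ ∘ₗ (idH ⊗ₘ s) = Ψ ∘ₗ mulInner Sinv ∘ₗ (δ ⊗ₘ (δ ⊗ₘ LinearMap.id)) := by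
    ext a b c d
    have h := LinearMap.congr_fun (comul_comp_antipode_inverse hl hr) b
    simp only [LinearMap.comp_apply, LinearEquiv.coe_coe] at h
    simp [s, _root_.tmul, Ψ, h]
    generalize (comul a : H ⊗[k] H) = x
    generalize (comul b : H ⊗[k] H) = y
    induction x with
    | zero => simp
    | add x x' hx hx' => simp only [add_tmul, map_add, smul_add, hx, hx']
    | tmul a₁ a₂ =>
      induction y with
      | zero => simp
      | add y y' hy hy' => simp only [tmul_add, add_tmul, map_add, smul_add, hy, hy']
      | tmul b₁ b₂ =>
        simp [mulInner, pairInner, outerPairing, smul_smul, mul_comm]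
  calc tmul σ ∘ₗ (idH ⊗ₘ S2 σ' Sinv) ∘ₗ δ
      = (tmul σ ∘ₗ (idH ⊗ₘ s)) ∘ₗ Delta4 := by
        have : idH ⊗ₘ S2 σ' Sinv = (idH ⊗ₘ s) ∘ₗ (idH ⊗ₘ Delta3) := by
          rw [← TensorProduct.map_comp, LinearMap.comp_id]; rfl
        rw [this]; rfl
    _ = Ψ ∘ₗ mulInner Sinv ∘ₗ (δ ⊗ₘ (δ ⊗ₘ δ)) ∘ₗ Delta3 := by
        have : (δ ⊗ₘ (δ ⊗ₘ δ)) =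
            (δ ⊗ₘ (δ ⊗ₘ LinearMap.id)) ∘ₗ (idH ⊗ₘ (idH ⊗ₘ δ)) := by ext; simp
        rw [h₁, ← map_map_map_comul_comp_Delta3, this]; rfl
    _ = _ := by
        rw [mulInner_comp_Delta3 hl hr]
        ext a
        simp [Ψ, Algebra.algebraMap_eq_smul_one]

variable (Sinv) in
/-- `a ⊗ b ⊗ c ↦ c ⊗ S⁻¹(b) ⊗ a`. -/
def reverseMid : H ⊗[k] (H ⊗[k] H) →ₗ[k] H ⊗[k] (H ⊗[k] H) :=
  (idH ⊗ₘ ((Sinv ⊗ₘ idH) ∘ₗ (TensorProduct.comm k H H).toLinearMap)) ∘ₗ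
    (TensorProduct.comm k (H ⊗[k] H) H).toLinearMap ∘ₗ (assocH H H).symm.toLinearMap

variable (Sinv) in
/-- `(a₁ ⊗ a₂) ⊗ (b₁ ⊗ b₂) ⊗ (c₁ ⊗ c₂) ↦ f(c₁ ⊗ S⁻¹(b₂) ⊗ a₁) g(c₂ ⊗ S⁻¹(b₁) ⊗ a₂)`. -/
def reverseConv (f g : H ⊗[k] (H ⊗[k] H) →ₗ[k] k) :
    (H ⊗[k] H) ⊗[k] ((H ⊗[k] H) ⊗[k] (H ⊗[k] H)) →ₗ[k] k :=
  LinearMap.mul' k k ∘ₗ ((f ∘ₗ reverseMid Sinv) ⊗ₘ (g ∘ₗ reverseMid Sinv)) ∘ₗ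
    (TensorProduct.tensorTensorTensorComm k H H (H ⊗[k] H) (H ⊗[k] H)).toLinearMap ∘ₗ
    (LinearMap.id ⊗ₘ ((TensorProduct.tensorTensorTensorComm k H H H H).toLinearMap ∘ₗ
      ((TensorProduct.comm k H H).toLinearMap ⊗ₘ LinearMap.id)))

lemma conv_comp_reverseMid (f g : H ⊗[k] (H ⊗[k] H) →ₗ[k] k)
    (hl : Sinv ∘ₗ antipode k = LinearMap.id) (hr : antipode k ∘ₗ Sinv = LinearMap.id) :
    conv k f g ∘ₗ reverseMid Sinv = reverseConv Sinv f g ∘ₗ (δ ⊗ₘ (δ ⊗ₘ δ)) := by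
  ext a b c
  have h := LinearMap.congr_fun (comul_comp_antipode_inverse hl hr) b
  simp only [LinearMap.comp_apply, LinearEquiv.coe_coe] at h
  simp [conv, reverseConv, reverseMid, TensorProduct.comul_tmul, h,
    TensorProduct.AlgebraTensorModule.tensorTensorTensorComm_eq]
  generalize (comul a : H ⊗[k] H) = x
  generalize (comul b : H ⊗[k] H) = y
  generalize (comul c : H ⊗[k] H) = z
  induction x with
  | zero => simp
  | add x x' hx hx' => simp only [tmul_add, add_tmul, map_add, hx, hx']
  | tmul a₁ a₂ =>
    induction y with
    | zero => simp
    | add y y' hy hy' => simp only [tmul_add, add_tmul, map_add, hy, hy']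
    | tmul b₁ b₂ =>
      induction z with
      | zero => simp
      | add z z' hz hz' => simp only [tmul_add, add_tmul, map_add, hz, hz']
      | tmul c₁ c₂ => simp

lemma reverseConv_p1_23_comp_Delta3 {σ : H ⊗[k] H →ₗ[k] k} (f : H ⊗[k] (H ⊗[k] H) →ₗ[k] k)
    (hσ : ∀ h : H, σ (h ⊗ₜ 1) = counit h)
    (hl : Sinv ∘ₗ antipode k = LinearMap.id) (hr : antipode k ∘ₗ Sinv = LinearMap.id) :
    reverseConv Sinv f (p1_23 σ) ∘ₗ (δ ⊗ₘ (δ ⊗ₘ δ)) ∘ₗ Delta3 =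
      f ∘ₗ reverseMid Sinv ∘ₗ Delta3 := by
  let φ : H ⊗[k] (H ⊗[k] (H ⊗[k] H)) →ₗ[k] H := (TensorProduct.lid k H).toLinearMap ∘ₗ
    ((f ∘ₗ reverseMid Sinv) ⊗ₘ idH) ∘ₗ (assocH (H ⊗[k] H) H).symm.toLinearMap ∘ₗ
      (idH ⊗ₘ (assocH H H).symm.toLinearMap)
  have h₁ : reverseConv Sinv f (p1_23 σ) =
      (σ ∘ₗ (TensorProduct.comm k H H).toLinearMap ∘ₗ (idH ⊗ₘ φ)) ∘ₗ mulInner Sinv := by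
    ext a₁ a₂ b₁ b₂ c₁ c₂
    simp [reverseConv, reverseMid, φ, mulInner, pairInner, p1_23]
  have h₂ : φ ∘ₗ Delta4 = (TensorProduct.lid k H).toLinearMap ∘ₗ
      ((f ∘ₗ reverseMid Sinv) ⊗ₘ idH) ∘ₗ (Delta3 ⊗ₘ idH) ∘ₗ δ := by
    rw [map_Delta3_comp_comul]; rfl
  have h₃ : ε ∘ₗ (TensorProduct.lid k H).toLinearMap ∘ₗ
      ((f ∘ₗ reverseMid Sinv) ⊗ₘ idH) ∘ₗ (Delta3 ⊗ₘ idH) =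
      (TensorProduct.rid k k).toLinearMap ∘ₗ ((f ∘ₗ reverseMid Sinv ∘ₗ Delta3) ⊗ₘ LinearMap.id) ∘ₗ
        LinearMap.lTensor H ε := by
    ext a b
    simp [mul_comm]
  rw [h₁, LinearMap.comp_assoc, mulInner_comp_Delta3 hl hr]
  trans ε ∘ₗ φ ∘ₗ Delta4
  · ext a
    simp [hσ]
  · rw [h₂]
    trans (ε ∘ₗ (TensorProduct.lid k H).toLinearMap ∘ₗ
      ((f ∘ₗ reverseMid Sinv) ⊗ₘ idH) ∘ₗ (Delta3 ⊗ₘ idH)) ∘ₗ δ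
    · rfl
    · rw [h₃, LinearMap.comp_assoc, LinearMap.comp_assoc, lTensor_counit_comp_comul]
      ext a
      simp

lemma reverseConv_p12_p23 (σ σ' : H ⊗[k] H →ₗ[k] k) :
    reverseConv Sinv (p12 σ') (p23 σ) ∘ₗ (δ ⊗ₘ (δ ⊗ₘ δ)) =
      outerPairing Sinv σ σ' ∘ₗ (idH ⊗ₘ ((assocH H H).toLinearMap ∘ₗ (δ ⊗ₘ idH))) := by
  have h₁ : reverseConv Sinv (p12 σ') (p23 σ) = outerPairing Sinv σ σ' ∘ₗ
      (((TensorProduct.lid k H).toLinearMap ∘ₗ LinearMap.rTensor H ε) ⊗ₘ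
        ((assocH H H).toLinearMap ∘ₗ (LinearMap.id ⊗ₘ
          ((TensorProduct.rid k H).toLinearMap ∘ₗ LinearMap.lTensor H ε)))) := by
    ext a₁ a₂ b₁ b₂ c₁ c₂
    simp [reverseConv, reverseMid, outerPairing, p12, p23]
    ring
  rw [h₁]
  ext a b c
  simp

lemma p12_3_comp_reverseMid_comp_Delta3 {σ : H ⊗[k] H →ₗ[k] k}
    (hσ : ∀ h : H, σ ((1 : H) ⊗ₜ h) = counit h)
    (hl : Sinv ∘ₗ antipode k = LinearMap.id) (hr : antipode k ∘ₗ Sinv = LinearMap.id) :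
    p12_3 σ ∘ₗ reverseMid Sinv ∘ₗ Delta3 = ε := by
  have h₁ : p12_3 σ ∘ₗ reverseMid Sinv = σ ∘ₗ (TensorProduct.comm k H H).toLinearMap ∘ₗ
      (idH ⊗ₘ (LinearMap.mul' k H ∘ₗ (TensorProduct.comm k H H).toLinearMap ∘ₗ
        (Sinv ⊗ₘ idH))) := by
    ext a b c
    simp [p12_3, reverseMid]
  have h₂ : (idH ⊗ₘ (LinearMap.mul' k H ∘ₗ (TensorProduct.comm k H H).toLinearMap ∘ₗ
        (Sinv ⊗ₘ idH))) ∘ₗ Delta3 =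
      (idH ⊗ₘ Algebra.linearMap k H) ∘ₗ LinearMap.lTensor H ε ∘ₗ δ := by
    rw [Delta3, ← LinearMap.comp_assoc, ← TensorProduct.map_comp]
    simp only [LinearMap.comp_assoc]
    rw [mul_comm_antipode_inverse_left hl hr, ← LinearMap.comp_assoc]
    congr 1
    ext; simp
  rw [← LinearMap.comp_assoc, h₁, LinearMap.comp_assoc, LinearMap.comp_assoc, h₂,
    lTensor_counit_comp_comul]
  ext a
  simp [hσ]

lemma conv_p12_p12 {σ σ' : H ⊗[k] H →ₗ[k] k} (hσ' : conv k σ' σ = counit) :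
    conv k (p12 σ') (p12 σ) = counit := by
  let π : H ⊗[k] (H ⊗[k] H) →ₗc[k] H ⊗[k] H :=
    Coalgebra.TensorProduct.map (CoalgHom.id k H)
      ((Coalgebra.TensorProduct.rid k k H).toCoalgHom.comp
        (Coalgebra.TensorProduct.map (CoalgHom.id k H) (counitCoalgHom k H)))
  have hπ (τ : H ⊗[k] H →ₗ[k] k) : p12 τ = τ ∘ₗ π.toLinearMap := by
    ext a b c
    simp [p12, π]
  have h := LinearMap.convMul_comp_coalgHom_distrib (toConv σ') (toConv σ) π
  change conv k σ' σ ∘ₗ π.toLinearMap = conv k (σ' ∘ₗ π.toLinearMap) (σ ∘ₗ π.toLinearMap) at h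
  rw [hπ, hπ, ← h, hσ']
  exact CoalgHomClass.counit_comp π

lemma conv_p12_p23_mul_p1_23 {σ σ' : H ⊗[k] H →ₗ[k] k} (hσ : IsLeftCocycle σ)
    (hσ' : conv k σ' σ = counit) :
    conv k (conv k (p12 σ') (p23 σ)) (p1_23 σ) = p12_3 σ := by
  have h (f g : H ⊗[k] (H ⊗[k] H) →ₗ[k] k) : conv k f g = (toConv f * toConv g).ofConv := rfl
  have h₁ := hσ.2
  have h₂ := conv_p12_p12 hσ'
  simp only [h] at h₁ h₂ ⊢
  have h₁ := ofConv_injective h₁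
  have h₂ : toConv (p12 σ') * toConv (p12 σ) = 1 := by
    apply ofConv_injective
    rw [h₂]
    ext
    simp
  rw [toConv_ofConv, mul_assoc, h₁, ← mul_assoc, h₂, one_mul]

lemma outerPairing_comp_Delta4 {σ σ' : H ⊗[k] H →ₗ[k] k} (hσ : IsLeftCocycle σ)
    (hσ' : conv k σ' σ = counit)
    (hl : Sinv ∘ₗ antipode k = LinearMap.id) (hr : antipode k ∘ₗ Sinv = LinearMap.id) :
    outerPairing Sinv σ σ' ∘ₗ Delta4 = ε := by
  rw [← p12_3_comp_reverseMid_comp_Delta3 (fun h ↦ (hσ.1 h).2) hl hr,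
    ← conv_p12_p23_mul_p1_23 hσ hσ', ← LinearMap.comp_assoc, conv_comp_reverseMid _ _ hl hr,
    LinearMap.comp_assoc, reverseConv_p1_23_comp_Delta3 _ (fun h ↦ (hσ.1 h).1) hl hr,
    ← LinearMap.comp_assoc, conv_comp_reverseMid _ _ hl hr, reverseConv_p12_p23,
    LinearMap.comp_assoc, map_map_comul_comp_Delta3]

end AntipodeInverse

/-- `Σ S₂(h₁)·h₂ = ε(h)·1` and `Σ h₁·S₂(h₂) = ε(h)·1` in `A_σ`. -/
theorem stmt5 (σ σ' : H ⊗[k] H →ₗ[k] k)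
    (hσ : IsLeftCocycle σ) (hσ' : IsConvInverse σ σ')
    (Sinv : H →ₗ[k] H)
    (hS : Sinv ∘ₗ HopfAlgebra.antipode (R := k) = LinearMap.id ∧
      HopfAlgebra.antipode (R := k) ∘ₗ Sinv = LinearMap.id) :
    tmul σ ∘ₗ TensorProduct.map (S2 σ' Sinv) LinearMap.id ∘ₗ Coalgebra.comul
        = Algebra.linearMap k H ∘ₗ Coalgebra.counit ∧
    tmul σ ∘ₗ TensorProduct.map LinearMap.id (S2 σ' Sinv) ∘ₗ Coalgebra.comul
        = Algebra.linearMap k H ∘ₗ Coalgebra.counit := by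
  refine ⟨tmul_S2_left hσ'.2 hS.1 hS.2, ?_⟩
  rw [← outerPairing_comp_Delta4 hσ hσ'.2 hS.1 hS.2]
  exact tmul_S2_right hS.1 hS.2
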